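/- Let 𝒜 be a symmetric real tensor of order m ≥ 2 and dimension n ≥ 2. If 𝒜 is almost semi-positive, then 𝒜 has a negative H⁺⁺-eigenvalue, i.e., there exist λ < 0 and x ∈ ℝⁿ with x > 0 componentwise such that (𝒜x^{m−1})_i = λ x_i^{m−1} for all i. -/

import Mathlib

/-- `(A x^{m-1})_i` for an order-`m = k+2`, dimension-`n` tensor `A`. -/
def tmul {n k : ℕ} (A : (Fin (k + 2) → Fin n) → ℝ) (x : Fin n → ℝ) (i : Fin n) : ℝ :=
  ∑ f : Fin (k + 1) → Fin n, A (Fin.cons i f) * ∏ j, x (f j)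

/-- `A` is semi-positive. -/
def SemiPos {n k : ℕ} (A : (Fin (k + 2) → Fin n) → ℝ) : Prop :=
  ∀ x : Fin n → ℝ, (∀ i, 0 ≤ x i) → x ≠ 0 → ∃ j, 0 < x j ∧ 0 ≤ tmul A x j

/-- The principal subtensor of `A` indexed by `J` is semi-positive (expressed via
vectors supported on `J`). -/
def SemiPosOn {n k : ℕ} (A : (Fin (k + 2) → Fin n) → ℝ) (J : Finset (Fin n)) : Prop :=
  ∀ x : Fin n → ℝ, (∀ i, 0 ≤ x i) → (∀ i, i ∉ J → x i = 0) → x ≠ 0 →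
    ∃ j, 0 < x j ∧ 0 ≤ tmul A x j

/-- `A` is almost semi-positive. -/
def AlmostSemiPos {n k : ℕ} (A : (Fin (k + 2) → Fin n) → ℝ) : Prop :=
  (∀ J : Finset (Fin n), J.Nonempty → J ≠ Finset.univ → SemiPosOn A J) ∧
    ∃ x : Fin n → ℝ, (∀ i, 0 < x i) ∧ ∀ i, tmul A x i < 0

/-- The homogeneous form `A x^m` of an order-`m = k+2` tensor. -/
def tpow {n k : ℕ} (A : (Fin (k + 2) → Fin n) → ℝ) (x : Fin n → ℝ) : ℝ :=
  ∑ g : Fin (k + 2) → Fin n, A g * ∏ j, x (g j)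

/-- `A` is symmetric: invariant under every permutation of the indices. -/
def SymTensor {n k : ℕ} (A : (Fin (k + 2) → Fin n) → ℝ) : Prop :=
  ∀ (g : Fin (k + 2) → Fin n) (σ : Equiv.Perm (Fin (k + 2))), A (g ∘ σ) = A g

/-- `A` is copositive. -/
def Copos {n k : ℕ} (A : (Fin (k + 2) → Fin n) → ℝ) : Prop :=
  ∀ x : Fin n → ℝ, (∀ i, 0 ≤ x i) → 0 ≤ tpow A x

/-- The principal subtensor of `A` indexed by `J` is copositive. -/
def CoposOn {n k : ℕ} (A : (Fin (k + 2) → Fin n) → ℝ) (J : Finset (Fin n)) : Prop :=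
  ∀ x : Fin n → ℝ, (∀ i, 0 ≤ x i) → (∀ i, i ∉ J → x i = 0) → 0 ≤ tpow A x

/-- `A` is almost copositive. -/
def AlmostCopos {n k : ℕ} (A : (Fin (k + 2) → Fin n) → ℝ) : Prop :=
  ¬ Copos A ∧ ∀ J : Finset (Fin n), J.Nonempty → J ≠ Finset.univ → CoposOn A J

lemma tpow_eq_sum_mul_tmul {n k : ℕ} (A : (Fin (k + 2) → Fin n) → ℝ) (x : Fin n → ℝ) :
    tpow A x = ∑ i, x i * tmul A x i := by
  unfold tpow tmul
  rw [← (Fin.consEquiv (fun _ : Fin (k + 2) => Fin n)).sum_comp, Fintype.sum_prod_type]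
  refine Finset.sum_congr rfl fun i _ => ?_
  rw [Finset.mul_sum]
  refine Finset.sum_congr rfl fun f _ => ?_
  have hf : Fin.consEquiv (fun _ : Fin (k + 2) => Fin n) (i, f) = Fin.cons i f := rfl
  simp only [hf, Fin.prod_univ_succ (n := k + 1), Fin.cons_zero, Fin.cons_succ]
  ring

lemma tpow_smul {n k : ℕ} (A : (Fin (k + 2) → Fin n) → ℝ) (c : ℝ) (x : Fin n → ℝ) :
    tpow A (c • x) = c ^ (k + 2) * tpow A x := by
  simp only [tpow, Pi.smul_apply, smul_eq_mul, Finset.prod_mul_distrib, Finset.prod_const,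
    Finset.card_univ, Fintype.card_fin, Finset.mul_sum]
  exact Finset.sum_congr rfl fun g _ => by ring

lemma continuous_tpow {n k : ℕ} (A : (Fin (k + 2) → Fin n) → ℝ) : Continuous (tpow A) := by
  unfold tpow
  fun_prop

lemma SymTensor.insertNth {n k : ℕ} {A : (Fin (k + 2) → Fin n) → ℝ} (hA : SymTensor A)
    (l : Fin (k + 2)) (i : Fin n) (f : Fin (k + 1) → Fin n) :
    A (l.insertNth (α := fun _ => Fin n) i f) = A (Fin.cons i f) := by
  rw [← hA _ l.cycleRange.symm]
  congr 1
  funext j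
  exact Fin.insertNth_apply_cycleRange_symm l i f j

/-- The partial derivatives of the form of a symmetric tensor. -/
lemma SymTensor.hasDerivAt_tpow_update {n k : ℕ} {A : (Fin (k + 2) → Fin n) → ℝ}
    (hA : SymTensor A) (x : Fin n → ℝ) (i : Fin n) :
    HasDerivAt (fun t => tpow A (Function.update x i t)) ((k + 2) * tmul A x i) (x i) := by
  have hcoord (p : Fin n) :
      HasDerivAt (fun t => Function.update x i t p) (if p = i then 1 else 0) (x i) := by
    by_cases hp : p = i
    · subst hp
      simpa using hasDerivAt_id' (x p)
    · simpa [Function.update_of_ne hp, hp] using hasDerivAt_const (x i) (x p)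
  have hder := HasDerivAt.fun_sum (u := Finset.univ) fun (g : Fin (k + 2) → Fin n) _ =>
    (HasDerivAt.fun_finsetProd (u := Finset.univ) fun l _ => hcoord (g l)).const_mul (A g)
  refine hder.congr_deriv ?_
  simp only [Function.update_eq_self, smul_eq_mul, Finset.mul_sum]
  rw [Finset.sum_comm]
  have hslot (l : Fin (k + 2)) :
      ∑ g : Fin (k + 2) → Fin n, A g * ((∏ j ∈ Finset.univ.erase l, x (g j)) *
        if g l = i then 1 else 0) = tmul A x i := by
    rw [← (Fin.insertNthEquiv (fun _ => Fin n) l).sum_comp, Fintype.sum_prod_type,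
      Finset.sum_eq_single i]
    · refine Finset.sum_congr rfl fun f _ => ?_
      have hl : (Finset.univ.erase l : Finset (Fin (k + 2))) =
          Finset.univ.map l.succAboveEmb := by
        ext j
        simp [Fin.exists_succAbove_eq_iff]
      have hf : A (Fin.insertNthEquiv (fun _ => Fin n) l (i, f)) = A (Fin.cons i f) :=
        hA.insertNth l i f
      rw [hf]
      simp [hl]
    · intro b _ hb
      simp [hb]
    · simp
  simp only [hslot]
  simp

/-- A form that is negative somewhere on the nonnegative orthant has a minimiser,
normalised in the `ℓ^m` norm, and it bounds the form from below. -/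
lemma exists_tpow_minimiser {n k : ℕ} (A : (Fin (k + 2) → Fin n) → ℝ)
    {y : Fin n → ℝ} (hy : ∀ i, 0 ≤ y i) (hneg : tpow A y < 0) :
    ∃ lam < 0, ∃ x : Fin n → ℝ, (∀ i, 0 ≤ x i) ∧ x ≠ 0 ∧
      tpow A x = lam * ∑ i, x i ^ (k + 2) ∧
      ∀ z : Fin n → ℝ, (∀ i, 0 ≤ z i) → lam * ∑ i, z i ^ (k + 2) ≤ tpow A z := by
  set K : Set (Fin n → ℝ) := Set.Icc 0 1 ∩ {x | ∑ i, x i ^ (k + 2) = 1}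
  have hK : IsCompact K :=
    isCompact_Icc.inter_right (isClosed_eq (by fun_prop) continuous_const)
  have h_zero : tpow A 0 = 0 := by simp [tpow]
  have hscale (z : Fin n → ℝ) (hz : ∀ i, 0 ≤ z i) (hz0 : z ≠ 0) :
      0 < ∑ i, z i ^ (k + 2) ∧ ∃ w ∈ K, tpow A z = (∑ i, z i ^ (k + 2)) * tpow A w := by
    obtain ⟨p, hp⟩ := Function.ne_iff.1 hz0
    have hs : 0 < ∑ i, z i ^ (k + 2) :=
      Finset.sum_pos' (fun i _ => pow_nonneg (hz i) _)
        ⟨p, Finset.mem_univ _, pow_pos ((hz p).lt_of_ne' hp) _⟩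
    refine ⟨hs, ?_⟩
    set s := ∑ i, z i ^ (k + 2) with hs_def
    obtain ⟨c, hc, hcs⟩ : ∃ c : ℝ, 0 < c ∧ c ^ (k + 2) = s :=
      ⟨s ^ (((k + 2 : ℕ) : ℝ)⁻¹), by positivity, Real.rpow_inv_natCast_pow hs.le (by omega)⟩
    have hsum : ∑ i, (c⁻¹ • z) i ^ (k + 2) = 1 := by
      simp only [Pi.smul_apply, smul_eq_mul, mul_pow, ← Finset.mul_sum, inv_pow, hcs, ← hs_def]
      exact inv_mul_cancel₀ hs.ne'
    have hnn (i : Fin n) : 0 ≤ (c⁻¹ • z) i := mul_nonneg (inv_pos.2 hc).le (hz i)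
    refine ⟨c⁻¹ • z, ⟨⟨hnn, fun i => ?_⟩, hsum⟩, ?_⟩
    · have hle : (c⁻¹ • z) i ^ (k + 2) ≤ 1 := hsum ▸
        Finset.single_le_sum (f := fun j => (c⁻¹ • z) j ^ (k + 2))
          (fun j _ => pow_nonneg (hnn j) _) (Finset.mem_univ i)
      exact (pow_le_one_iff_of_nonneg (hnn i) (by omega)).1 hle
    · rw [← hcs, ← tpow_smul, smul_inv_smul₀ hc.ne']
  have hy0 : y ≠ 0 := by
    rintro rfl
    exact hneg.ne h_zero
  obtain ⟨hsy, w, hwK, hw⟩ := hscale y hy hy0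
  obtain ⟨x, hxK, hmin⟩ := hK.exists_isMinOn ⟨w, hwK⟩ (continuous_tpow A).continuousOn
  refine ⟨tpow A x, ?_, x, hxK.1.1, ?_, ?_, fun z hz => ?_⟩
  · have hw_neg : tpow A w < 0 := by
      by_contra! h
      exact hneg.not_ge (hw ▸ mul_nonneg hsy.le h)
    exact (hmin hwK).trans_lt hw_neg
  · rintro rfl
    simpa using hxK.2
  · rw [hxK.2, mul_one]
  · by_cases hz0 : z = 0
    · simp [hz0, h_zero]
    · obtain ⟨hsz, v, hvK, hv⟩ := hscale z hz hz0
      rw [hv, mul_comm]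
      exact mul_le_mul_of_nonneg_left (hmin hvK) hsz.le

/-- First-order optimality along the coordinates on which the minimiser is positive. -/
lemma SymTensor.tmul_eq_of_minimiser {n k : ℕ} {A : (Fin (k + 2) → Fin n) → ℝ}
    (hA : SymTensor A) {lam : ℝ} {x : Fin n → ℝ} (hx : ∀ i, 0 ≤ x i)
    (heq : tpow A x = lam * ∑ i, x i ^ (k + 2))
    (hmin : ∀ z : Fin n → ℝ, (∀ i, 0 ≤ z i) → lam * ∑ i, z i ^ (k + 2) ≤ tpow A z)
    {i : Fin n} (hi : 0 < x i) : tmul A x i = lam * x i ^ (k + 1) := by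
  have hpow : HasDerivAt (fun t => ∑ j, Function.update x i t j ^ (k + 2))
      ((k + 2) * x i ^ (k + 1)) (x i) := by
    have hsplit : (fun t => ∑ j, Function.update x i t j ^ (k + 2)) =
        fun t => t ^ (k + 2) + ∑ j ∈ Finset.univ.erase i, x j ^ (k + 2) := by
      funext t
      rw [← Finset.add_sum_erase _ _ (Finset.mem_univ i), Function.update_self]
      congr 1
      refine Finset.sum_congr rfl fun j hj => ?_
      rw [Function.update_of_ne (Finset.ne_of_mem_erase hj)]
    rw [hsplit]
    simpa using (hasDerivAt_pow (k + 2) (x i)).add_const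
      (∑ j ∈ Finset.univ.erase i, x j ^ (k + 2))
  have hloc : IsLocalMin (fun t => tpow A (Function.update x i t) -
      lam * ∑ j, Function.update x i t j ^ (k + 2)) (x i) := by
    filter_upwards [lt_mem_nhds hi] with t ht
    have hz (j : Fin n) : 0 ≤ Function.update x i t j := by
      by_cases hj : j = i
      · subst hj
        simpa using ht.le
      · simpa [Function.update_of_ne hj] using hx j
    have := hmin _ hz
    simp only [Function.update_eq_self]
    linarith
  have h := hloc.hasDerivAt_eq_zero ((hA.hasDerivAt_tpow_update x i).sub (hpow.const_mul lam))
  have hk : (k + 2 : ℝ) ≠ 0 := by positivity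
  refine mul_left_cancel₀ hk ?_
  linarith

/-- a symmetric almost semi-positive tensor has a negative
H⁺⁺-eigenvalue. -/
theorem stmt_19 {n k : ℕ} (hn : 2 ≤ n) (A : (Fin (k + 2) → Fin n) → ℝ)
    (hsym : SymTensor A) (hA : AlmostSemiPos A) :
    ∃ lam : ℝ, lam < 0 ∧
      ∃ x : Fin n → ℝ, (∀ i, 0 < x i) ∧ ∀ i, tmul A x i = lam * x i ^ (k + 1) := by
  obtain ⟨hsub, y, hy, hAy⟩ := hA
  have hneg : tpow A y < 0 := by
    rw [tpow_eq_sum_mul_tmul]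
    exact Finset.sum_neg (fun i _ => mul_neg_of_pos_of_neg (hy i) (hAy i))
      ⟨⟨0, by omega⟩, Finset.mem_univ _⟩
  obtain ⟨lam, hlam, x, hx, hx0, heq, hmin⟩ :=
    exists_tpow_minimiser A (fun i => (hy i).le) hneg
  have heig (i : Fin n) (hi : 0 < x i) : tmul A x i = lam * x i ^ (k + 1) :=
    hsym.tmul_eq_of_minimiser hx heq hmin hi
  have hpos (i : Fin n) : 0 < x i := by
    by_contra hi
    obtain ⟨p, hp⟩ := Function.ne_iff.1 hx0
    obtain ⟨j, hj, hAj⟩ := hsub (Finset.univ.filter fun j => 0 < x j)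
      ⟨p, by simpa using (hx p).lt_of_ne' hp⟩
      (fun h => hi (Finset.filter_eq_self.1 h i (Finset.mem_univ i))) x hx
      (fun j hj => le_antisymm (by simpa using hj) (hx j)) hx0
    rw [heig j hj] at hAj
    exact hAj.not_gt (mul_neg_of_neg_of_pos hlam (pow_pos hj _))
  exact ⟨lam, hlam, x, hpos, fun i => heig i (hpos i)⟩
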